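/- The N = rn entire functions φ_{i,j}(x) = γ_i·f_j(x+λ_i) + f_j′(x+λ_i), for 1 ≤ i ≤ n and 1 ≤ j ≤ r, are linearly independent over ℂ. In particular, the Wronskian determinant det Wr(φ_1, …, φ_N) does not vanish identically. -/

import Mathlib

open scoped BigOperators

/-- The generalized Airy operator `L₀ u = u^(r) - ∑_{k=1}^{r-2} a_k u^(k) - x·u`. -/
noncomputable def airyOp (r : ℕ) (a : ℕ → ℂ) (u : ℂ → ℂ) : ℂ → ℂ :=
  fun x => iteratedDeriv r u x
    - (∑ k ∈ Finset.Ico 1 (r - 1), a k * iteratedDeriv k u x) - x * u x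

/-- The Wronskian determinant of an `m`-tuple of functions. -/
noncomputable def wrDet (m : ℕ) (g : Fin m → ℂ → ℂ) (x : ℂ) : ℂ :=
  Matrix.det (Matrix.of fun k s : Fin m => iteratedDeriv k.val (g s) x)

/-- The bordered Wronskian determinant `det Wr(g₁, …, g_m, u)`. -/
noncomputable def wrDetB (m : ℕ) (g : Fin m → ℂ → ℂ) (u : ℂ → ℂ) (x : ℂ) : ℂ :=
  wrDet (m + 1) (Fin.snoc g u) x

/-- The family `φ_{i,j}(x) = γ_i·f_j(x+λ_i) + f_j'(x+λ_i)`, listed in a fixed order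
as `φ_1, …, φ_N` with `N = r·n` (index `k` corresponds to `i = k / r`, `j = k % r`). -/
noncomputable def phiFam (r n : ℕ) (f : ℕ → ℂ → ℂ) (lam gam : ℕ → ℂ) :
    Fin (r * n) → ℂ → ℂ :=
  fun k x => gam (k.val / r) * f (k.val % r) (x + lam (k.val / r)) +
    deriv (f (k.val % r)) (x + lam (k.val / r))

/-- The Vandermonde-type product `V = ∏_{i<j} (λ_i - λ_j)`. -/
noncomputable def vand (n : ℕ) (lam : ℕ → ℂ) : ℂ :=
  ∏ i ∈ Finset.range n, ∏ j ∈ Finset.Ico (i + 1) n, (lam i - lam j)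

theorem Differentiable.iteratedDeriv_complex {u : ℂ → ℂ} (hu : Differentiable ℂ u) (k : ℕ) :
    Differentiable ℂ (iteratedDeriv k u) :=
  (hu.contDiff (n := ⊤)).differentiable_iteratedDeriv k (by exact_mod_cast WithTop.coe_lt_top _)

/-- The space of entire functions. -/
def entireFunctions : Submodule ℂ (ℂ → ℂ) where
  carrier := {u | Differentiable ℂ u}
  add_mem' hu hv := Differentiable.add hu hv
  zero_mem' := differentiable_const 0
  smul_mem' c _ hu := Differentiable.const_smul hu c

theorem mem_entireFunctions {u : ℂ → ℂ} : u ∈ entireFunctions ↔ Differentiable ℂ u := Iff.rfl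

/-- Differentiation as an endomorphism of the space of entire functions. -/
noncomputable def derivEnd : Module.End ℂ entireFunctions where
  toFun u := ⟨deriv u, mem_entireFunctions.2 u.2.deriv⟩
  map_add' u v := by
    ext x
    exact deriv_add (u.2 x) (v.2 x)
  map_smul' c u := by
    ext x
    exact deriv_const_smul c (u.2 x)

/-- Multiplication by the variable as an endomorphism of the space of entire functions. -/
def mulIdEnd : Module.End ℂ entireFunctions where
  toFun u := ⟨fun x => x * (u : ℂ → ℂ) x,
    mem_entireFunctions.2 (differentiable_id.mul u.2)⟩
  map_add' u v := by
    ext x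
    exact mul_add x _ _
  map_smul' c u := by
    ext x
    exact mul_left_comm x c _

/-- The generalized Airy operator as an endomorphism of the space of entire functions. -/
noncomputable def airyEnd (r : ℕ) (a : ℕ → ℂ) : Module.End ℂ entireFunctions :=
  derivEnd ^ r - ∑ k ∈ Finset.Ico 1 (r - 1), a k • derivEnd ^ k - mulIdEnd

theorem coe_derivEnd (u : entireFunctions) : (derivEnd u : ℂ → ℂ) = deriv u := rfl

theorem coe_derivEnd_pow (k : ℕ) (u : entireFunctions) :
    ((derivEnd ^ k) u : ℂ → ℂ) = iteratedDeriv k u := by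
  induction k with
  | zero => simp
  | succ k ih => rw [pow_succ', Module.End.mul_apply, coe_derivEnd, ih, iteratedDeriv_succ]

theorem coe_airyEnd (r : ℕ) (a : ℕ → ℂ) (u : entireFunctions) :
    (airyEnd r a u : ℂ → ℂ) = airyOp r a u := by
  ext x
  simp [airyEnd, airyOp, coe_derivEnd_pow, LinearMap.sum_apply, mulIdEnd]

theorem derivEnd_mulIdEnd_apply (u : entireFunctions) :
    derivEnd (mulIdEnd u) = mulIdEnd (derivEnd u) + u := by
  ext x
  have h : deriv (fun y => y * (u : ℂ → ℂ) y) x = x * deriv u x + (u : ℂ → ℂ) x := by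
    rw [deriv_fun_mul differentiableAt_fun_id (mem_entireFunctions.1 u.2 x)]
    simp [add_comm]
  exact h

theorem airyEnd_derivEnd_apply (r : ℕ) (a : ℕ → ℂ) (u : entireFunctions) :
    airyEnd r a (derivEnd u) = derivEnd (airyEnd r a u) + u := by
  have hpow (k : ℕ) : (derivEnd ^ k) (derivEnd u) = derivEnd ((derivEnd ^ k) u) := by
    rw [← Module.End.mul_apply, ← Module.End.mul_apply, ← pow_succ, ← pow_succ']
  simp only [airyEnd, LinearMap.sub_apply, LinearMap.sum_apply, LinearMap.smul_apply, map_sub,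
    map_sum, map_smul, hpow, derivEnd_mulIdEnd_apply]
  abel

theorem airyEnd_sub_smul_add_derivEnd {r : ℕ} {a : ℕ → ℂ} {μ : ℂ} {v : entireFunctions}
    (hv : airyEnd r a v = μ • v) (c : ℂ) :
    (airyEnd r a - μ • 1) (c • v + derivEnd v) = v := by
  simp only [LinearMap.sub_apply, LinearMap.smul_apply, Module.End.one_apply, map_add, map_smul,
    airyEnd_derivEnd_apply, hv, sub_self, smul_zero, zero_add, add_sub_cancel_left]

theorem smul_add_derivEnd_mem_maxGenEigenspace {r : ℕ} {a : ℕ → ℂ} {μ : ℂ} {v : entireFunctions}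
    (hv : airyEnd r a v = μ • v) (c : ℂ) :
    c • v + derivEnd v ∈ (airyEnd r a).maxGenEigenspace μ := by
  rw [Module.End.mem_maxGenEigenspace]
  refine ⟨2, ?_⟩
  rw [pow_two, Module.End.mul_apply, airyEnd_sub_smul_add_derivEnd hv]
  simp [hv]

/-- Eigenvectors of the Airy operator with distinct eigenvalues stay independent under
`v ↦ γ v + v'`. -/
theorem eq_zero_of_sum_smul_add_derivEnd_eq_zero {ι : Type*} [Fintype ι] {r : ℕ} {a : ℕ → ℂ}
    {μ c : ι → ℂ} (hμ : Function.Injective μ) {v : ι → entireFunctions}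
    (hv : ∀ i, airyEnd r a (v i) = μ i • v i)
    (hsum : ∑ i, (c i • v i + derivEnd (v i)) = 0) (i : ι) : v i = 0 := by
  have hind := (airyEnd r a).independent_maxGenEigenspace.comp hμ
  have h := (iSupIndep_iff_finsetSum_eq_zero_imp_eq_zero _).1 hind Finset.univ
    (fun i => c i • v i + derivEnd (v i))
    (fun i _ => smul_add_derivEnd_mem_maxGenEigenspace (hv i) (c i)) hsum i (Finset.mem_univ i)
  rw [← airyEnd_sub_smul_add_derivEnd (hv i) (c i), h, map_zero]

theorem airyOp_comp_add_const (r : ℕ) (a : ℕ → ℂ) (u : ℂ → ℂ) (μ x : ℂ) :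
    airyOp r a (fun y => u (y + μ)) x = airyOp r a u (x + μ) + μ * u (x + μ) := by
  simp only [airyOp, iteratedDeriv_comp_add_const]
  ring

theorem iteratedDeriv_sum_const_mul {ι : Type*} [Fintype ι] {g : ι → ℂ → ℂ}
    (hg : ∀ i, Differentiable ℂ (g i)) (c : ι → ℂ) (k : ℕ) (x : ℂ) :
    iteratedDeriv k (fun y => ∑ i, c i * g i y) x = ∑ i, c i * iteratedDeriv k (g i) x := by
  rw [iteratedDeriv_fun_sum fun i _ => (((hg i).const_mul (c i)).contDiff).contDiffAt]
  simp

theorem airyOp_sum_const_mul {ι : Type*} [Fintype ι] {g : ι → ℂ → ℂ}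
    (hg : ∀ i, Differentiable ℂ (g i)) (c : ι → ℂ) (r : ℕ) (a : ℕ → ℂ) (x : ℂ) :
    airyOp r a (fun y => ∑ i, c i * g i y) x = ∑ i, c i * airyOp r a (g i) x := by
  simp only [airyOp, iteratedDeriv_sum_const_mul hg, Finset.mul_sum, mul_sub,
    Finset.sum_sub_distrib]
  rw [Finset.sum_comm]
  simp only [mul_left_comm]

theorem linearIndependent_of_wrDet_ne_zero {m : ℕ} {g : Fin m → ℂ → ℂ}
    (hg : ∀ i, Differentiable ℂ (g i)) {x : ℂ} (hx : wrDet m g x ≠ 0) :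
    LinearIndependent ℂ g := by
  rw [Fintype.linearIndependent_iff]
  intro c hc
  refine congrFun (Matrix.eq_zero_of_mulVec_eq_zero hx (funext fun k => ?_))
  have hc' : (fun y => ∑ i, c i * g i y) = 0 := by
    rw [← hc]
    ext y
    simp
  have h := iteratedDeriv_sum_const_mul hg c k x
  rw [hc'] at h
  simpa [Matrix.mulVec, dotProduct, mul_comm] using h.symm

theorem differentiable_det {m : ℕ} {A : ℂ → Matrix (Fin m) (Fin m) ℂ}
    (hA : ∀ i j, Differentiable ℂ fun x => A x i j) : Differentiable ℂ fun x => (A x).det := by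
  simp only [Matrix.det_apply]
  fun_prop

theorem Differentiable.eq_zero_of_eventuallyEq {u : ℂ → ℂ} (hu : Differentiable ℂ u) {x : ℂ}
    (h : u =ᶠ[nhds x] 0) : u = 0 :=
  AnalyticOnNhd.eq_of_eventuallyEq (fun y _ => hu.analyticAt y) (fun _ _ => analyticAt_const) h

/-- If the Wronskian of `m + 1` entire functions vanishes identically, then the cofactors of the
last row of the Wronskian matrix give an entire relation between the columns. -/
theorem exists_relation_of_wrDet_eq_zero {m : ℕ} {g : Fin (m + 1) → ℂ → ℂ}
    (hg : ∀ i, Differentiable ℂ (g i)) (hW : ∀ x, wrDet (m + 1) g x = 0) :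
    ∃ C : Fin (m + 1) → ℂ → ℂ, (∀ s, Differentiable ℂ (C s)) ∧
      (C (Fin.last m) = wrDet m fun i => g i.castSucc) ∧
      ∀ k ≤ m, ∀ x, ∑ s, iteratedDeriv k (g s) x * C s x = 0 := by
  let W : ℂ → Matrix (Fin (m + 1)) (Fin (m + 1)) ℂ :=
    fun x => Matrix.of fun k s => iteratedDeriv k.val (g s) x
  refine ⟨fun s x => (W x).adjugate s (Fin.last m), fun s => ?_, ?_, fun k hk x => ?_⟩
  · simp only [Matrix.adjugate_apply]
    refine differentiable_det fun k j => ?_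
    by_cases h : k = Fin.last m
    · subst h
      simp
    · simp only [Matrix.updateRow_ne h]
      exact (hg j).iteratedDeriv_complex k
  · ext x
    simp only [Matrix.adjugate_fin_succ_eq_det_submatrix, ← two_mul, pow_mul]
    simp [wrDet, W, Matrix.submatrix, Matrix.of_apply]
  · have h := congrFun₂ (Matrix.mul_adjugate (W x)) ⟨k, Nat.lt_succ_of_le hk⟩ (Fin.last m)
    have hd : (W x).det = 0 := hW x
    simpa [hd, Matrix.mul_apply, W] using h

theorem exists_wrDet_ne_zero {m : ℕ} {g : Fin m → ℂ → ℂ} (hg : ∀ i, Differentiable ℂ (g i))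
    (hli : LinearIndependent ℂ g) : ∃ x, wrDet m g x ≠ 0 := by
  induction m with
  | zero => exact ⟨0, by simp [wrDet]⟩
  | succ m ih =>
    by_contra! hW
    obtain ⟨x₀, hx₀⟩ := ih (fun i => hg i.castSucc)
      (hli.comp Fin.castSucc (Fin.castSucc_injective m))
    obtain ⟨C, hC, hlast, hrel⟩ := exists_relation_of_wrDet_eq_zero hg hW
    obtain ⟨ε, hε, hball⟩ := Metric.eventually_nhds_iff_ball.1
      (((hC (Fin.last m)).continuous.continuousAt (x := x₀)).eventually_ne (hlast ▸ hx₀))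
    have hrel' (k : ℕ) (hk : k < m) (x : ℂ) :
        ∑ s, iteratedDeriv k (g s) x * deriv (C s) x = 0 := by
      have hd : HasDerivAt (fun y => ∑ s, iteratedDeriv k (g s) y * C s y)
          (∑ s, (iteratedDeriv (k + 1) (g s) x * C s x +
            iteratedDeriv k (g s) x * deriv (C s) x)) x := by
        refine HasDerivAt.fun_sum fun s _ => ?_
        rw [iteratedDeriv_succ]
        exact (((hg s).iteratedDeriv_complex k) x).hasDerivAt.mul ((hC s) x).hasDerivAt
      have h0 : (fun y => ∑ s, iteratedDeriv k (g s) y * C s y) = fun _ => 0 :=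
        funext (hrel k hk.le)
      rw [h0] at hd
      have h := hd.unique (hasDerivAt_const x (0 : ℂ))
      rwa [Finset.sum_add_distrib, hrel (k + 1) hk, zero_add] at h
    have hwr (s : Fin (m + 1)) (x : ℂ) (hx : x ∈ Metric.ball x₀ ε) :
        deriv (C s) x * C (Fin.last m) x - C s x * deriv (C (Fin.last m)) x = 0 := by
      refine Fin.lastCases (by ring) (fun i => ?_) s
      have hdet : wrDet m (fun i => g i.castSucc) x ≠ 0 := hlast ▸ hball x hx
      refine congrFun (Matrix.eq_zero_of_mulVec_eq_zero (v := fun i : Fin m =>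
        deriv (C i.castSucc) x * C (Fin.last m) x - C i.castSucc x * deriv (C (Fin.last m)) x)
        hdet (funext fun k => ?_)) i
      have h₁ := hrel k k.2.le x
      have h₂ := hrel' k k.2 x
      rw [Fin.sum_univ_castSucc] at h₁ h₂
      simp only [Matrix.mulVec, dotProduct, Matrix.of_apply, mul_sub, ← mul_assoc,
        Finset.sum_sub_distrib, ← Finset.sum_mul, Pi.zero_apply]
      linear_combination C (Fin.last m) x * h₂ - deriv (C (Fin.last m)) x * h₁
    have hconst (s : Fin (m + 1)) (x : ℂ) (hx : x ∈ Metric.ball x₀ ε) :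
        C s x / C (Fin.last m) x = C s x₀ / C (Fin.last m) x₀ := by
      refine Metric.isOpen_ball.is_const_of_deriv_eq_zero
        (f := fun y => C s y / C (Fin.last m) y)
        (convex_ball x₀ ε).isPreconnected (fun y hy => ?_) (fun y hy => ?_) hx
        (Metric.mem_ball_self hε)
      · exact (((hC s) y).div ((hC _) y) (hball y hy)).differentiableWithinAt
      · rw [deriv_fun_div ((hC s) y) ((hC _) y) (hball y hy), hwr s y hy, zero_div, Pi.zero_apply]
    have hzero : (fun x => ∑ s, C s x₀ / C (Fin.last m) x₀ * g s x) = 0 := by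
      refine Differentiable.eq_zero_of_eventuallyEq (x := x₀)
        (Differentiable.fun_sum fun s _ => (hg s).const_mul _) ?_
      filter_upwards [Metric.ball_mem_nhds x₀ hε] with x hx
      have h := hrel 0 (Nat.zero_le m) x
      calc ∑ s, C s x₀ / C (Fin.last m) x₀ * g s x
          = ∑ s, (g s x * C s x) / C (Fin.last m) x :=
            Finset.sum_congr rfl fun s _ => by rw [← hconst s x hx]; ring
        _ = 0 := by
            rw [← Finset.sum_div]
            simpa using Or.inl h
    have hc := Fintype.linearIndependent_iff.1 hli (fun s => C s x₀ / C (Fin.last m) x₀)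
      (by rw [← hzero]; ext x; simp) (Fin.last m)
    rw [div_self (hlast ▸ hx₀)] at hc
    exact one_ne_zero hc

theorem differentiable_phiFam {r n : ℕ} {f : ℕ → ℂ → ℂ} (lam gam : ℕ → ℂ) (hr : 0 < r)
    (hf : ∀ j < r, Differentiable ℂ (f j)) (k : Fin (r * n)) :
    Differentiable ℂ (phiFam r n f lam gam k) := by
  have h := hf (k.val % r) (Nat.mod_lt _ hr)
  have h' := h.deriv
  unfold phiFam
  fun_prop

theorem linearIndependent_phiFam {r n : ℕ} {a : ℕ → ℂ} {f : ℕ → ℂ → ℂ} {lam : ℕ → ℂ}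
    (gam : ℕ → ℂ) (hf : ∀ j < r, Differentiable ℂ (f j))
    (hker : ∀ j < r, ∀ x : ℂ, airyOp r a (f j) x = 0)
    (hli : LinearIndependent ℂ fun j : Fin r => f j)
    (hlam : Function.Injective fun i : Fin n => lam i) :
    LinearIndependent ℂ (phiFam r n f lam gam) := by
  let e : Fin n × Fin r ≃ Fin (r * n) := finProdFinEquiv.trans (finCongr (mul_comm n r))
  have hdiv (i : Fin n) (j : Fin r) : (e (i, j)).val / r = i := by
    simp [e, Nat.add_mul_div_left _ _ j.pos, Nat.div_eq_of_lt j.2]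
  have hmod (i : Fin n) (j : Fin r) : (e (i, j)).val % r = j := by
    simp [e, Nat.mod_eq_of_lt j.2]
  rw [← linearIndependent_equiv e, Fintype.linearIndependent_iff]
  rintro c hc ⟨i, j⟩
  have hG (i : Fin n) : Differentiable ℂ fun x => ∑ j : Fin r, c (i, j) * f j x :=
    Differentiable.fun_sum fun j _ => (hf j j.2).const_mul _
  let v : Fin n → entireFunctions := fun i =>
    ⟨fun x => (fun y => ∑ j : Fin r, c (i, j) * f j y) (x + lam i),
      (hG i).comp (differentiable_id.add_const (lam i))⟩
  have hv (i : Fin n) : airyEnd r a (v i) = lam i • v i := by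
    ext x
    rw [coe_airyEnd]
    refine (airyOp_comp_add_const r a (fun y => ∑ j : Fin r, c (i, j) * f j y) (lam i) x).trans ?_
    rw [airyOp_sum_const_mul fun j : Fin r => hf j j.2]
    simp [hker _ (Fin.is_lt _), v]
  have hsum : ∑ i : Fin n, (gam i • v i + derivEnd (v i)) = 0 := by
    ext x
    have hx := congrFun hc x
    rw [Fintype.sum_prod_type] at hx
    simp only [Finset.sum_apply, Pi.smul_apply, Function.comp_apply, phiFam, hdiv, hmod,
      smul_eq_mul, Pi.zero_apply] at hx
    simp only [Submodule.coe_sum, Submodule.coe_add, Submodule.coe_smul, Finset.sum_apply,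
      Pi.add_apply, Pi.smul_apply, coe_derivEnd, smul_eq_mul, Submodule.coe_zero, Pi.zero_apply]
    rw [← hx]
    refine Finset.sum_congr rfl fun i _ => ?_
    have hd : deriv (v i : ℂ → ℂ) x = ∑ j : Fin r, c (i, j) * deriv (f j) (x + lam i) := by
      refine (deriv_comp_add_const (fun y => ∑ j : Fin r, c (i, j) * f j y) (lam i) x).trans ?_
      simpa using iteratedDeriv_sum_const_mul (fun j : Fin r => hf j j.2)
        (fun j => c (i, j)) 1 (x + lam i)
    rw [hd]
    simp only [v, Finset.mul_sum, ← Finset.sum_add_distrib]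
    exact Finset.sum_congr rfl fun j _ => by ring
  have hvi := eq_zero_of_sum_smul_add_derivEnd_eq_zero hlam hv hsum i
  refine Fintype.linearIndependent_iff.1 hli (fun j => c (i, j)) ?_ j
  ext x
  have h := congrFun (congrArg Subtype.val hvi) (x - lam i)
  simpa [v] using h

theorem statement10 (r n : ℕ) (a : ℕ → ℂ) (f : ℕ → ℂ → ℂ) (lam gam : ℕ → ℂ)
    (hr : 2 ≤ r) (hn : 1 ≤ n)
    (hf : ∀ j < r, Differentiable ℂ (f j))
    (hker : ∀ j < r, ∀ x : ℂ, airyOp r a (f j) x = 0)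
    (hwrf : ∀ x : ℂ, wrDet r (fun j => f j.val) x = 1)
    (hlam : ∀ i < n, ∀ j < n, i ≠ j → lam i ≠ lam j) :
    LinearIndependent ℂ (phiFam r n f lam gam) ∧
      ∃ x : ℂ, wrDet (r * n) (phiFam r n f lam gam) x ≠ 0 := by
  have hli := linearIndependent_of_wrDet_ne_zero (x := 0) (fun j : Fin r => hf j j.2)
    (by rw [hwrf]; exact one_ne_zero)
  have hφ := linearIndependent_phiFam gam hf hker hli fun i j hij =>
    by_contra fun h => hlam i i.2 j j.2 (fun h' => h (Fin.ext h')) hij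
  exact ⟨hφ, exists_wrDet_ne_zero (differentiable_phiFam lam gam (by omega) hf) hφ⟩
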